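/- arXiv:2405.02086 — 3 statements merged into one kernel-verified Lean document; each statement's English description precedes it below -/
import Mathlib

section
/- Let y ∈ ℝ^n and 0 < η < ‖y‖₁. Then there exists a unique λ > 0 such that Σ_{i=1}^n max(|y_i| − λ, 0) = η, and the Euclidean projection of y onto the ℓ1 ball B_η^1 = {x : Σ_i |x_i| ≤ η} is the soft-thresholding x*_i = sign(y_i)·max(|y_i| − λ, 0) for every i; moreover this x* is the unique minimizer of ‖x − y‖₂ over B_η^1. -/
theorem abs_softThreshold {t : ℝ} (ht : 0 < t) (a : ℝ) :
    |Real.sign a * max (|a| - t) 0| = max (|a| - t) 0 := by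
  rw [abs_mul, abs_of_nonneg (le_max_right (|a| - t) 0)]
  rcases lt_trichotomy a 0 with h | rfl | h
  · simp [Real.sign_of_neg h]
  · simp [ht.le]
  · simp [Real.sign_of_pos h]

/-- The soft-thresholding of `a` minimizes `x ↦ (x - a) ^ 2 + 2 * t * |x|`, with quadratic growth. -/
theorem softThreshold_growth {t : ℝ} (ht : 0 < t) (a x : ℝ) :
    (Real.sign a * max (|a| - t) 0 - a) ^ 2 + (x - Real.sign a * max (|a| - t) 0) ^ 2
      + 2 * t * (max (|a| - t) 0 - |x|) ≤ (x - a) ^ 2 := by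
  rcases le_total |a| t with h | h
  · rw [max_eq_right (by linarith)]
    have h2 : x * a ≤ |x| * t :=
      (le_abs_self _).trans (by rw [abs_mul]; gcongr)
    nlinarith
  · rw [max_eq_left (by linarith)]
    have h3 : 0 < |a| := ht.trans_le h
    rcases lt_or_gt_of_ne (abs_pos.mp h3) with ha | ha
    · rw [Real.sign_of_neg ha, abs_of_neg ha]
      nlinarith [mul_nonneg ht.le (sub_nonneg.mpr (neg_abs_le x))]
    · rw [Real.sign_of_pos ha, abs_of_pos ha]
      nlinarith [mul_nonneg ht.le (sub_nonneg.mpr (le_abs_self x))]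

theorem sum_max_sub_lt {ι : Type*} [Fintype ι] {a : ι → ℝ} {s t : ℝ} (hst : s < t)
    (hpos : 0 < ∑ i, max (a i - s) 0) :
    ∑ i, max (a i - t) 0 < ∑ i, max (a i - s) 0 := by
  obtain ⟨i, hi, hi'⟩ := Finset.exists_lt_of_sum_lt (s := Finset.univ) (f := fun _ : ι => (0 : ℝ))
    (g := fun i => max (a i - s) 0) (by simpa using hpos)
  refine Finset.sum_lt_sum (fun j _ => by gcongr) ⟨i, hi, ?_⟩
  have : 0 < a i - s := by simpa using hi'
  rw [max_eq_left this.le]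
  exact max_lt (by linarith) this

theorem exists_sum_max_abs_sub_eq {ι : Type*} [Fintype ι] (y : ι → ℝ) {η : ℝ}
    (h0 : 0 < η) (h1 : η < ∑ i, |y i|) :
    ∃ t : ℝ, 0 < t ∧ ∑ i, max (|y i| - t) 0 = η := by
  have hS : 0 ≤ ∑ i, |y i| := (h0.trans h1).le
  have hcont : ContinuousOn (fun t : ℝ => ∑ i, max (|y i| - t) 0) (Set.Icc 0 (∑ i, |y i|)) := by
    fun_prop
  have htop : ∑ i, max (|y i| - ∑ j, |y j|) 0 = 0 :=
    Finset.sum_eq_zero fun i hi => max_eq_right <| sub_nonpos.mpr <|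
      Finset.single_le_sum (f := fun j => |y j|) (fun j _ => abs_nonneg _) hi
  obtain ⟨t, ht, hteq⟩ := intermediate_value_Ioo' hS hcont
    (show η ∈ Set.Ioo _ _ from ⟨by simpa [htop] using h0, by simpa using h1⟩)
  exact ⟨t, ht.1, hteq⟩

/-- For `y ∈ ℝ^n` and `0 < η < ‖y‖₁`, there is a unique `λ > 0` with
`Σ_i max (|y i| - λ) 0 = η`, and the soft-thresholding
`x* i = sign (y i) * max (|y i| - λ) 0` is the unique Euclidean projection
of `y` onto the `ℓ1` ball of radius `η`. -/
theorem proj_l1_ball_soft_threshold (n : ℕ) (y : Fin n → ℝ) (η : ℝ)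
    (h0 : 0 < η) (h1 : η < ∑ i, |y i|) :
    ∃ lam : ℝ, 0 < lam ∧ ((∑ i, max (|y i| - lam) 0) = η) ∧
      (∀ lam' : ℝ, 0 < lam' → (∑ i, max (|y i| - lam') 0) = η → lam' = lam) ∧
      ((∑ i, |Real.sign (y i) * max (|y i| - lam) 0|) ≤ η) ∧
      (∀ x : Fin n → ℝ, (∑ i, |x i|) ≤ η →
        (∑ i, (Real.sign (y i) * max (|y i| - lam) 0 - y i) ^ 2) ≤
          ∑ i, (x i - y i) ^ 2) ∧
      (∀ x : Fin n → ℝ,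
        ((∑ i, |x i|) ≤ η ∧ ∀ z : Fin n → ℝ, (∑ i, |z i|) ≤ η →
          (∑ i, (x i - y i) ^ 2) ≤ ∑ i, (z i - y i) ^ 2) →
        x = fun i => Real.sign (y i) * max (|y i| - lam) 0) := by
  obtain ⟨t, ht, hsum⟩ := exists_sum_max_abs_sub_eq y h0 h1
  have hgrowth : ∀ x : Fin n → ℝ, (∑ i, |x i|) ≤ η →
      (∑ i, (Real.sign (y i) * max (|y i| - t) 0 - y i) ^ 2)
        + (∑ i, (x i - Real.sign (y i) * max (|y i| - t) 0) ^ 2) ≤ ∑ i, (x i - y i) ^ 2 := by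
    intro x hx
    have h := Finset.sum_le_sum fun i (_ : i ∈ Finset.univ) => softThreshold_growth ht (y i) (x i)
    rw [Finset.sum_add_distrib, Finset.sum_add_distrib, ← Finset.mul_sum,
      Finset.sum_sub_distrib, hsum] at h
    have := mul_nonneg (mul_nonneg zero_le_two ht.le) (sub_nonneg.mpr hx)
    linarith
  have hfeas : ∑ i, |Real.sign (y i) * max (|y i| - t) 0| ≤ η := by
    simp only [abs_softThreshold ht, hsum, le_refl]
  refine ⟨t, ht, hsum, fun t' _ hsum' => ?_, hfeas, fun x hx => ?_, fun x hx => ?_⟩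
  · rcases lt_trichotomy t' t with h | h | h
    · have := sum_max_sub_lt h (h0.trans_eq hsum'.symm)
      linarith
    · exact h
    · have := sum_max_sub_lt h (h0.trans_eq hsum.symm)
      linarith
  · exact (le_add_of_nonneg_right (Finset.sum_nonneg fun i _ => sq_nonneg _)).trans (hgrowth x hx)
  · have hle := hx.2 _ hfeas
    have hdist : ∑ i, (x i - Real.sign (y i) * max (|y i| - t) 0) ^ 2 = 0 :=
      le_antisymm (by linarith [hgrowth x hx.1]) (Finset.sum_nonneg fun i _ => sq_nonneg _)
    funext i
    have := (Finset.sum_eq_zero_iff_of_nonneg fun i _ => sq_nonneg _).mp hdist i (Finset.mem_univ i)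
    exact sub_eq_zero.mp (pow_eq_zero_iff two_ne_zero |>.mp this)
end

section
/- Let Y ∈ ℝ^{n×m} with columns y_1,…,y_m, let η ≥ 0, let û be the Euclidean projection of the vector (‖y_1‖_∞,…,‖y_m‖_∞) onto the ℓ1 ball of radius η, and define X ∈ ℝ^{n×m} by X_{i,j} = sign(Y_{i,j})·min(|Y_{i,j}|, û_j). Then ‖X‖_{1,∞} = Σ_{j=1}^m max_{i} |X_{i,j}| ≤ η, i.e., the output of the bi-level ℓ_{1,∞} projection always satisfies the ℓ_{1,∞} constraint. -/
/-- Clipping a real number at level `u` produces a value of modulus at most `|u|`,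
whatever the sign of `u`. -/
theorem abs_sign_mul_min_abs_le (y u : ℝ) : |Real.sign y * min |y| u| ≤ |u| := by
  have hsign : |Real.sign y| ≤ 1 := by
    rcases Real.sign_apply_eq y with h | h | h <;> simp [h]
  have hmin : |min |y| u| ≤ |u| :=
    abs_le.2 ⟨le_min ((neg_nonpos.2 (abs_nonneg u)).trans (abs_nonneg y)) (neg_abs_le u),
      (min_le_right _ _).trans (le_abs_self u)⟩
  rw [abs_mul]
  exact (mul_le_of_le_one_left (abs_nonneg _) hsign).trans hmin

/-- Feasibility of the bi-level `ℓ_{1,∞}` projection: if `uhat` is the Euclidean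
projection of the vector of column infinity norms `(⨆ i, |Y i j|)_j` onto the `ℓ1`
ball of radius `η ≥ 0`, and `X` is obtained by clipping each column of `Y` at level
`uhat j`, i.e. `X i j = sign (Y i j) * min |Y i j| (uhat j)`, then
`‖X‖_{1,∞} = Σ_j max_i |X i j| ≤ η`. -/
theorem bilevel_l1inf_feasible (n m : ℕ) (Y : Matrix (Fin n) (Fin m) ℝ) (η : ℝ)
    (hη : 0 ≤ η) (uhat : Fin m → ℝ)
    (hball : (∑ j, |uhat j|) ≤ η)
    (hmin : ∀ u : Fin m → ℝ, (∑ j, |u j|) ≤ η →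
      (∑ j, (uhat j - (⨆ i, |Y i j|)) ^ 2) ≤ ∑ j, (u j - (⨆ i, |Y i j|)) ^ 2) :
    (∑ j, ⨆ i, |Real.sign (Y i j) * min |Y i j| (uhat j)|) ≤ η := by
  refine (Finset.sum_le_sum fun j _ => ?_).trans hball
  exact Real.iSup_le (fun i => abs_sign_mul_min_abs_le (Y i j) (uhat j)) (abs_nonneg _)
end

section
/- Let 𝒴 ∈ ℝ^{c×n×m} be an order-3 tensor, η ≥ 0. Let V ∈ ℝ^{n×m} be the channel aggregation V_{i,j} = max_{k=1,…,c} |𝒴_{k,i,j}|, let û ∈ ℝ^m be the Euclidean projection of the vector (max_i V_{i,1},…,max_i V_{i,m}) onto the ℓ1 ball of radius η, let U ∈ ℝ^{n×m} be obtained by clipping each column of V at the corresponding û_j, and define 𝒳 by 𝒳_{k,i,j} = sign(𝒴_{k,i,j})·min(|𝒴_{k,i,j}|, U_{i,j}). Then Σ_{j=1}^m max_{i,k} |𝒳_{k,i,j}| ≤ η, i.e., the output of the tri-level ℓ_{1,∞,∞} projection satisfies the ℓ_{1,∞,∞} constraint of radius η. -/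
/-- Coordinatewise clipping at level `u` (the Euclidean projection of a scalar onto
the interval `[−u, u]` when `u ≥ 0`). -/
noncomputable def clip (y u : ℝ) : ℝ := Real.sign y * min |y| u

/-- Clipping at level `u` bounds the absolute value by `|u|`, whatever the sign of `u`. -/
theorem abs_clip_le (y u : ℝ) : |clip y u| ≤ |u| := by
  have hsign : |Real.sign y| ≤ 1 := by
    rcases Real.sign_apply_eq y with h | h | h <;> simp [h]
  have hclip : |min |y| u| ≤ |u| := by
    rcases le_total |y| u with h | h
    · rw [min_eq_left h, abs_abs]
      exact h.trans (le_abs_self u)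
    · rw [min_eq_right h]
  rw [clip, abs_mul]
  exact (mul_le_of_le_one_left (abs_nonneg _) hsign).trans hclip

/-- Feasibility of the tri-level `ℓ_{1,∞,∞}` projection for an order-3 tensor
`Y ∈ ℝ^{c×n×m}`: aggregate the channels into `V i j = max_k |Y k i j|`, let `uhat` be
the Euclidean projection of the vector of column maxima `(max_i V i j)_j` onto the
`ℓ1` ball of radius `η ≥ 0`, clip each column of `V` at `uhat j` to get `U`, and clip
each channel fiber of `Y` at `U i j` to get `X`. Then
`Σ_j max_{i,k} |X k i j| ≤ η`. -/
theorem trilevel_l1infinf_feasible (c n m : ℕ) (Y : Fin c → Fin n → Fin m → ℝ)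
    (η : ℝ) (hη : 0 ≤ η) (uhat : Fin m → ℝ)
    (hball : (∑ j, |uhat j|) ≤ η)
    (hmin : ∀ u : Fin m → ℝ, (∑ j, |u j|) ≤ η →
      (∑ j, (uhat j - (⨆ i, ⨆ k, |Y k i j|)) ^ 2) ≤
        ∑ j, (u j - (⨆ i, ⨆ k, |Y k i j|)) ^ 2) :
    (∑ j, ⨆ i, ⨆ k,
      |clip (Y k i j) (clip (⨆ k', |Y k' i j|) (uhat j))|) ≤ η := by
  refine (Finset.sum_le_sum fun j _ => ?_).trans hball
  exact Real.iSup_le (fun i => Real.iSup_le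
    (fun k => (abs_clip_le _ _).trans (abs_clip_le _ _)) (abs_nonneg _)) (abs_nonneg _)
end
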